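/- arXiv:math/0612187 — 2 statements merged into one kernel-verified Lean document; each statement's English description precedes it below -/
import Mathlib

section
/- Let r ≥ 1, n ≥ 0, and let m, ℓ ≥ 0 with n − m even and ℓ ≤ (n−m)/2. Let k ∈ {0,1} with k ≡ r (mod 2). Then the number of involutions π ∈ I_{r,n} with fix(π) = m and exc_A(π) = ℓ equals ((n−m)/2)!·(r−1)^{(n−m)/2 − ℓ}·C(n; (n−m)/2, m, (n−m)/2 − ℓ, ℓ)·2^{(m(3−2k) − n)/2} (an equality of rational numbers). -/
open Finset MvPolynomial

/-- The colored permutation group `G_{r,n}`: pairs `(z, τ)` with `z : (ℤ/rℤ)ⁿ`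
and `τ` a permutation of `[n]`. -/
abbrev ColoredPerm (r n : ℕ) : Type := (Fin n → ZMod r) × Equiv.Perm (Fin n)

/-- Multiplication in `G_{r,n}`:
`(z, τ)(z', τ') = ((zᵢ + z'_{τ⁻¹(i)})ᵢ, τ ∘ τ')`. -/
def cpMul {r n : ℕ} (x y : ColoredPerm r n) : ColoredPerm r n :=
  (fun i => x.1 i + y.1 (x.2⁻¹ i), x.2 * y.2)

/-- The identity element of `G_{r,n}`. -/
def cpOne (r n : ℕ) : ColoredPerm r n := (fun _ => 0, 1)

/-- `π` is an involution: `π² = 1`. -/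
def IsCPInvolution {r n : ℕ} (π : ColoredPerm r n) : Prop := cpMul π π = cpOne r n

instance {r n : ℕ} (π : ColoredPerm r n) : Decidable (IsCPInvolution π) :=
  decidable_of_iff (cpMul π π = cpOne r n) Iff.rfl

/-- `csum π = Σᵢ zᵢ(π)`, each color regarded as an integer in `{0, …, r−1}`. -/
def csum {r n : ℕ} (π : ColoredPerm r n) : ℕ := ∑ i, (π.1 i).val

/-- `fix π`: the number of absolute fixed points, `#{i ∈ [n] : τ(i) = i}`. -/
noncomputable def fixc {r n : ℕ} (π : ColoredPerm r n) : ℕ := Nat.card {i : Fin n // π.2 i = i}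

/-- `exc_A π = #{i ∈ {1, …, n−1} : z_{τ(i)}(π) = 0 and τ(i) > i}`
(`Fin n` encodes `[n]` via `i ↦ i + 1`, so `i ∈ {1, …, n−1}` reads `(i : ℕ) + 1 < n`). -/
noncomputable def excA {r n : ℕ} (π : ColoredPerm r n) : ℕ :=
  Nat.card {i : Fin n // (i : ℕ) + 1 < n ∧ π.1 (π.2 i) = 0 ∧ i < π.2 i}

/-- The colored excedance number `exc^Clr π = r·exc_A π + csum π`. -/
noncomputable def excClr {r n : ℕ} (π : ColoredPerm r n) : ℕ := r * excA π + csum π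

/-- The multinomial coefficient `C(n; a₁, …, a_k) = n!/(a₁!⋯a_k!)` when all
entries are nonnegative and sum to `n`, and `0` otherwise. -/
def multinomialZ (n : ℤ) (l : List ℤ) : ℕ :=
  if (∀ a ∈ l, 0 ≤ a) ∧ l.sum = n then
    n.toNat.factorial / (l.map fun a => a.toNat.factorial).prod
  else 0

/-- The number of functions taking a given value exactly `l` times. -/
theorem card_fun_card_fiber_eq {ι κ : Type*} [Fintype ι] [DecidableEq ι] [Fintype κ]
    [DecidableEq κ] (a : κ) (l : ℕ) :
    #{f : ι → κ | #{i | f i = a} = l} =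
      (Fintype.card ι).choose l * (Fintype.card κ - 1) ^ (Fintype.card ι - l) := by
  rw [card_eq_sum_card_fiberwise (f := fun f => ({i | f i = a} : Finset ι))
    (t := powersetCard l univ) (by intro f hf; simpa [mem_powersetCard] using hf),
    sum_const_nat (m := (Fintype.card κ - 1) ^ (Fintype.card ι - l)), card_powersetCard, card_univ]
  · intro S hS
    rw [mem_powersetCard] at hS
    have h : ({f ∈ ({f : ι → κ | #{i | f i = a} = l} : Finset (ι → κ)) |
        ({i | f i = a} : Finset ι) = S} : Finset (ι → κ)) =
        Fintype.piFinset fun i => if i ∈ S then {a} else {a}ᶜ := by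
      ext f
      simp only [mem_filter, mem_univ, true_and, Fintype.mem_piFinset]
      constructor
      · rintro ⟨-, rfl⟩ i
        by_cases hi : f i = a <;> simp [hi]
      · intro hf
        have hfS : ({i | f i = a} : Finset ι) = S := by
          ext i
          have := hf i
          by_cases hi : i ∈ S <;> simp_all
        exact ⟨hfS ▸ hS.2, hfS⟩
    rw [h, Fintype.card_piFinset, ← hS.2, ← card_compl, ← prod_const,
      ← prod_mul_prod_compl S,
      prod_congr rfl (g := fun _ => 1) fun i hi => by simp [hi],
      prod_congr rfl (s₁ := Sᶜ) (g := fun _ => Fintype.card κ - 1) fun i hi => by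
        rw [if_neg (mem_compl.1 hi), card_compl, card_singleton]]
    simp

/-- The number of `2`-torsion elements of `ℤ/rℤ`. -/
theorem ZMod.card_add_self_eq_zero (r : ℕ) [NeZero r] :
    Fintype.card {x : ZMod r // x + x = 0} = 2 ^ (1 - r % 2) := by
  have h (x : ZMod r) : x + x = 0 ↔ x = 0 ∨ 2 * x.val = r := by
    rw [← ZMod.neg_eq_self_iff, neg_eq_iff_add_eq_zero]
  rw [Fintype.card_subtype]
  obtain hr | hr := Nat.mod_two_eq_zero_or_one r
  · have hr0 := NeZero.pos r
    have hv : ((r / 2 : ℕ) : ZMod r).val = r / 2 := ZMod.val_cast_of_lt (by omega)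
    have : ({x : ZMod r | x + x = 0} : Finset (ZMod r)) = {0, ((r / 2 : ℕ) : ZMod r)} := by
      ext x
      simp only [mem_filter, mem_univ, true_and, mem_insert, mem_singleton, h]
      refine or_congr_right ⟨fun hx => ?_, fun hx => ?_⟩
      · apply ZMod.val_injective r
        omega
      · subst hx
        omega
    rw [this, card_pair, hr]
    · rfl
    · intro h0
      have := congrArg ZMod.val h0
      rw [hv, ZMod.val_zero] at this
      omega
  · have : ({x : ZMod r | x + x = 0} : Finset (ZMod r)) = {0} := by
      ext x
      simp only [mem_filter, mem_univ, true_and, mem_singleton, h]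
      exact or_iff_left fun hx => by omega
    rw [this, card_singleton, hr]
    rfl

/-- The number of involutive permutations with `m` fixed points and `p` transpositions. -/
theorem card_involutive_perm_mul (m p : ℕ) :
    #{τ : Equiv.Perm (Fin (m + 2 * p)) | τ * τ = 1 ∧ #{i | τ i = i} = m} *
      (m.factorial * 2 ^ p * p.factorial) = (m + 2 * p).factorial := by
  have key := Equiv.Perm.card_of_cycleType_mul_eq (Fin (m + 2 * p)) (Multiset.replicate p 2)
  have hset (τ : Equiv.Perm (Fin (m + 2 * p))) :
      τ.cycleType = Multiset.replicate p 2 ↔ τ * τ = 1 ∧ #{i | τ i = i} = m := by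
    have hfix : #{i | τ i = i} + τ.cycleType.sum = m + 2 * p := by
      have hs : τ.support = ({i | ¬ τ i = i} : Finset _) := by
        ext i
        simp
      rw [Equiv.Perm.sum_cycleType, hs, card_filter_add_card_filter_not, card_univ,
        Fintype.card_fin]
    constructor
    · intro h
      rw [h, Multiset.sum_replicate, smul_eq_mul] at hfix
      refine ⟨?_, by omega⟩
      rw [← sq, Equiv.Perm.pow_prime_eq_one_iff, h]
      exact fun c hc => Multiset.eq_of_mem_replicate hc
    · rintro ⟨h, hm⟩
      rw [← sq] at h
      have hc := Equiv.Perm.cycleType_of_pow_prime_eq_one h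
      rw [hc, Multiset.sum_replicate, smul_eq_mul] at hfix
      rw [hc]
      congr 1
      omega
  simp_rw [hset] at key
  rw [if_pos ⟨by simp [mul_comm], fun a ha => (Multiset.eq_of_mem_replicate ha).ge⟩] at key
  rw [Fintype.card_fin] at key
  rw [← key]
  congr 2
  · rw [Multiset.sum_replicate, Multiset.prod_replicate, smul_eq_mul, mul_comm p 2,
      Nat.add_sub_cancel]
  · rcases p.eq_zero_or_pos with rfl | hp
    · simp
    · have : (Multiset.replicate p 2).toFinset = {2} := by
        ext x
        simp [hp.ne']
      simp [this]

/-- The colourings making an involutive permutation into an involution of `G_{r,n}` are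
determined by `2`-torsion colours at the fixed points and arbitrary colours at the smaller
element of each transposition. -/
def involutionColoringEquiv {α M : Type*} [LinearOrder α] [AddGroup M]
    (τ : Equiv.Perm α) (hτ : τ * τ = 1) :
    {z : α → M // ∀ i, z i + z (τ i) = 0} ≃
      ({i // τ i = i} → {x : M // x + x = 0}) × ({i // i < τ i} → M) where
  toFun z := (fun i => ⟨z.1 i, by simpa [i.2] using z.2 i⟩, fun i => z.1 i)
  invFun gf := ⟨fun i =>
      if h : τ i = i then gf.1 ⟨i, h⟩
      else if h' : i < τ i then gf.2 ⟨i, h'⟩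
      else -gf.2 ⟨τ i, by
        rw [← Equiv.Perm.mul_apply, hτ]
        exact lt_of_le_of_ne (not_lt.1 h') h⟩, fun i => by
    have hi : τ (τ i) = i := by rw [← Equiv.Perm.mul_apply, hτ, Equiv.Perm.one_apply]
    rcases lt_trichotomy i (τ i) with h | h | h
    · simp [hi, h, h.ne, h.ne', h.not_gt]
    · simp [h.symm, (gf.1 ⟨i, h.symm⟩).2]
    · simp [hi, h, h.ne, h.ne', h.not_gt]⟩
  left_inv z := by
    ext i
    dsimp only
    split_ifs with h h'
    · rfl
    · rfl
    · exact (eq_neg_of_add_eq_zero_left (z.2 i)).symm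
  right_inv gf := by
    ext i
    · simp [i.2]
    · simp [i.2, i.2.ne']

/-- An involution of `Fin n` has one excedance for each transposition. -/
theorem card_fixed_add_two_mul_card_lt {n : ℕ} (τ : Equiv.Perm (Fin n)) (hτ : τ * τ = 1) :
    #{i | τ i = i} + 2 * #{i | i < τ i} = n := by
  have hi (i) : τ (τ i) = i := by rw [← Equiv.Perm.mul_apply, hτ, Equiv.Perm.one_apply]
  have hgt : #{i | τ i < i} = #{i | i < τ i} :=
    card_bij' (fun i _ => τ i) (fun i _ => τ i) (by simp [hi]) (by simp [hi])
      (by simp [hi]) (by simp [hi])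
  have h1 := card_filter_add_card_filter_not (s := univ) (fun i => τ i = i)
  have h2 := card_filter_add_card_filter_not (s := ({i | ¬ τ i = i} : Finset _))
    (fun i => i < τ i)
  rw [filter_filter, filter_filter] at h2
  have e1 : #{i | ¬ τ i = i ∧ i < τ i} = #{i | i < τ i} := by
    congr 1
    ext i
    simpa using fun h => ne_of_gt h
  have e2 : #{i | ¬ τ i = i ∧ ¬ i < τ i} = #{i | τ i < i} := by
    congr 1
    ext i
    simp only [mem_filter, mem_univ, true_and, not_lt]
    exact ⟨fun h => lt_of_le_of_ne h.2 h.1, fun h => ⟨h.ne, h.le⟩⟩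
  rw [e1, e2, hgt] at h2
  rw [card_univ, Fintype.card_fin] at h1
  omega

theorem isCPInvolution_iff {r n : ℕ} (π : ColoredPerm r n) :
    IsCPInvolution π ↔ π.2 * π.2 = 1 ∧ ∀ i, π.1 i + π.1 (π.2 i) = 0 := by
  simp only [IsCPInvolution, cpMul, cpOne, Prod.ext_iff, funext_iff]
  rw [and_comm]
  refine and_congr_right fun h => ?_
  rw [inv_eq_of_mul_eq_one_left h]

/-- The number of colourings with `l` excedances of an involutive permutation. -/
theorem card_involution_colorings {r m p : ℕ} [NeZero r] (l : ℕ)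
    (τ : Equiv.Perm (Fin (m + 2 * p))) (hτ : τ * τ = 1) (hm : #{i | τ i = i} = m) :
    Nat.card {z : Fin (m + 2 * p) → ZMod r //
        (∀ i, z i + z (τ i) = 0) ∧ excA ((z, τ) : ColoredPerm r (m + 2 * p)) = l} =
      (2 ^ (1 - r % 2)) ^ m * (p.choose l * (r - 1) ^ (p - l)) := by
  have hp : #{i | i < τ i} = p := by
    have := card_fixed_add_two_mul_card_lt τ hτ
    omega
  let e := involutionColoringEquiv (M := ZMod r) τ hτ
  have hexc (z : {z : Fin (m + 2 * p) → ZMod r // ∀ i, z i + z (τ i) = 0}) :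
      excA ((z.1, τ) : ColoredPerm r (m + 2 * p)) = #{i | (e z).2 i = 0} := by
    rw [excA, ← Fintype.card_subtype, ← Nat.card_eq_fintype_card]
    refine Nat.card_congr ((Equiv.subtypeEquivRight fun i => ?_).trans
      (Equiv.subtypeSubtypeEquivSubtypeInter _ fun i => z.1 i = 0).symm)
    have h0 : z.1 (τ i) = 0 ↔ z.1 i = 0 := by
      rw [← neg_eq_zero, ← eq_neg_of_add_eq_zero_left (z.2 i)]
    simp only [h0]
    constructor
    · tauto
    · rintro ⟨h, hz⟩
      exact ⟨by have := (τ i).2; omega, hz, h⟩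
  rw [Nat.card_congr (Equiv.subtypeSubtypeEquivSubtypeInter _ fun z : Fin (m + 2 * p) → ZMod r =>
      excA ((z, τ) : ColoredPerm r (m + 2 * p)) = l).symm]
  rw [Nat.card_congr (e.subtypeEquiv (q := fun gf => #{i | gf.2 i = 0} = l)
    fun z => by rw [hexc])]
  rw [Nat.card_congr (β := ({i // τ i = i} → {x : ZMod r // x + x = 0}) ×
      {f : {i // i < τ i} → ZMod r // #{i | f i = 0} = l})
    ⟨fun x => (x.1.1, ⟨x.1.2, x.2⟩), fun x => ⟨(x.1, x.2.1), x.2.2⟩, fun _ => rfl, fun _ => rfl⟩]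
  rw [Nat.card_prod, Nat.card_eq_fintype_card, Nat.card_eq_fintype_card, Fintype.card_fun,
    ZMod.card_add_self_eq_zero, Fintype.card_subtype, hm, Fintype.card_subtype,
    card_fun_card_fiber_eq, Fintype.card_subtype, hp, ZMod.card]

/-- The number of involutions of `G_{r,n}` with `m` absolute fixed points and `l` excedances. -/
theorem card_involutions_eq (r m p l : ℕ) [NeZero r] :
    Nat.card {π : ColoredPerm r (m + 2 * p) //
        IsCPInvolution π ∧ fixc π = m ∧ excA π = l} =
      #{τ : Equiv.Perm (Fin (m + 2 * p)) | τ * τ = 1 ∧ #{i | τ i = i} = m} *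
        ((2 ^ (1 - r % 2)) ^ m * (p.choose l * (r - 1) ^ (p - l))) := by
  have hfix (π : ColoredPerm r (m + 2 * p)) : fixc π = #{i | π.2 i = i} := by
    rw [fixc, Nat.card_eq_fintype_card, Fintype.card_subtype]
  let e : {π : ColoredPerm r (m + 2 * p) // IsCPInvolution π ∧ fixc π = m ∧ excA π = l} ≃
      Σ τ : {τ : Equiv.Perm (Fin (m + 2 * p)) // τ * τ = 1 ∧ #{i | τ i = i} = m},
        {z : Fin (m + 2 * p) → ZMod r //
          (∀ i, z i + z (τ.1 i) = 0) ∧ excA ((z, τ.1) : ColoredPerm r (m + 2 * p)) = l} :=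
    { toFun := fun π => ⟨⟨π.1.2, ((isCPInvolution_iff _).1 π.2.1).1,
          (hfix _).symm.trans π.2.2.1⟩, ⟨π.1.1, ((isCPInvolution_iff _).1 π.2.1).2, π.2.2.2⟩⟩
      invFun := fun x => ⟨(x.2.1, x.1.1), (isCPInvolution_iff _).2 ⟨x.1.2.1, x.2.2.1⟩,
          (hfix _).trans x.1.2.2, x.2.2.2⟩
      left_inv := fun _ => rfl
      right_inv := fun _ => rfl }
  rw [Nat.card_congr e, Nat.card_sigma,
    sum_congr rfl fun τ _ => card_involution_colorings l τ.1 τ.2.1 τ.2.2, sum_const, card_univ,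
    Fintype.card_subtype, smul_eq_mul]

theorem multinomialZ_four (a b c d : ℕ) :
    (multinomialZ ((a + b + c + d : ℕ) : ℤ) [(a : ℤ), b, c, d] : ℚ) =
      (a + b + c + d).factorial / (a.factorial * b.factorial * c.factorial * d.factorial) := by
  have h := Nat.multinomial_spec univ ![a, b, c, d]
  simp only [Fin.prod_univ_four, Fin.sum_univ_four] at h
  rw [multinomialZ, if_pos ⟨by simp, by simp; ring⟩]
  simp only [List.map, List.prod_cons, List.prod_nil, Int.toNat_natCast, mul_one]
  rw [Nat.cast_div]
  · push_cast
    ring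
  · exact Dvd.intro _ (by simpa [mul_assoc] using h)
  · positivity

/-- For `r ≥ 1`, `m, ℓ ≥ 0` with `n − m` even and `ℓ ≤ (n−m)/2`,
and `k ∈ {0,1}` with `k ≡ r (mod 2)`, the number of involutions `π ∈ I_{r,n}`
with `fix π = m` and `exc_A π = ℓ` equals
`((n−m)/2)!·(r−1)^{(n−m)/2−ℓ}·C(n; (n−m)/2, m, (n−m)/2−ℓ, ℓ)·2^{(m(3−2k)−n)/2}`,
as rational numbers. -/
theorem card_involutions_fix_excA (r n m l k : ℕ) (hr : 1 ≤ r)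
    (hm : Even ((n : ℤ) - m)) (hl : (l : ℤ) ≤ ((n : ℤ) - m) / 2)
    (hk : k ≤ 1) (hkr : k % 2 = r % 2) :
    (Nat.card {π : ColoredPerm r n //
        IsCPInvolution π ∧ fixc π = m ∧ excA π = l} : ℚ) =
      ((((n : ℤ) - m) / 2).toNat.factorial : ℚ) *
        ((r : ℚ) - 1) ^ ((((n : ℤ) - m) / 2 - l).toNat) *
        (multinomialZ n [((n : ℤ) - m) / 2, (m : ℤ), ((n : ℤ) - m) / 2 - l, (l : ℤ)] : ℚ) *
        (2 : ℚ) ^ ((((m : ℤ) * (3 - 2 * (k : ℤ)) - n) / 2)) := by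
  have : NeZero r := ⟨by omega⟩
  obtain ⟨p', hp'⟩ := hm
  have hhalf : ((n : ℤ) - m) / 2 = p' := by omega
  rw [hhalf] at hl ⊢
  obtain ⟨p, rfl⟩ := Int.eq_ofNat_of_zero_le (show 0 ≤ p' by omega)
  obtain rfl : n = m + 2 * p := by omega
  obtain ⟨q, rfl⟩ : ∃ q, p = q + l := ⟨p - l, by omega⟩
  have hq : ((q + l : ℕ) : ℤ) - l = (q : ℕ) := by omega
  have hk' : k = r % 2 := by omega
  have hexp : ((m : ℤ) * (3 - 2 * (k : ℤ)) - (m + 2 * (q + l) : ℕ)) / 2 =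
      ((1 - k) * m : ℕ) - ((q + l : ℕ) : ℤ) := by
    interval_cases k <;> push_cast <;> omega
  have hperm := congrArg (Nat.cast (R := ℚ)) (card_involutive_perm_mul m (q + l))
  have hmul := multinomialZ_four (q + l) m q l
  rw [show q + l + m + q + l = m + 2 * (q + l) by ring] at hmul
  have hch := Nat.add_choose_mul_factorial_mul_factorial q l
  replace hch := congrArg (Nat.cast (R := ℚ)) hch
  rw [hq, hexp, hmul, card_involutions_eq, zpow_sub₀ two_ne_zero, zpow_natCast, zpow_natCast,
    ← hk', Int.toNat_natCast, Int.toNat_natCast, Nat.add_sub_cancel, ← hperm, pow_mul]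
  push_cast [Nat.cast_sub hr] at hch ⊢
  rw [← hch]
  field_simp
end

section
/- Let r ≥ 2 be even, n ≥ 0, and m = r·k for a natural number k. The number of involutions π ∈ I_{r,n} with exc^Clr(π) = m equals Σ_{j=⌈n/2⌉}^{n} (n−j)!·C(n; n−j, n−j, n−2k, 2k−2n+2j)·(r/2)^{n−j}, where a multinomial coefficient is 0 whenever one of its lower entries is negative. -/
open Finset MvPolynomial

theorem sum_eq_sum_fixed_add_sum_exceedances {n : ℕ} {τ : Equiv.Perm (Fin n)}
    (hτ : ∀ i, τ (τ i) = i) (f : Fin n → ℕ) :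
    ∑ i, f i = ∑ i with τ i = i, f i + ∑ i with i < τ i, (f i + f (τ i)) := by
  have hswap : ∑ i with i < τ i, f (τ i) = ∑ i with τ i < i, f i := by
    refine Finset.sum_bij' (fun i _ => τ i) (fun i _ => τ i) ?_ ?_ ?_ ?_ ?_ <;>
      simp [hτ]
  rw [Finset.sum_add_distrib, hswap, ← Finset.sum_filter_add_sum_filter_not univ (fun i => τ i = i),
    ← Finset.sum_filter_add_sum_filter_not (univ.filter fun i => ¬ τ i = i) (fun i => i < τ i),
    Finset.filter_filter, Finset.filter_filter]
  congr 3 <;> ext i <;> simp <;> grind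

theorem card_fixed_add_two_mul_card_exceedances {n : ℕ} {τ : Equiv.Perm (Fin n)}
    (hτ : ∀ i, τ (τ i) = i) :
    #{i | τ i = i} + 2 * #{i | i < τ i} = n := by
  have h := sum_eq_sum_fixed_add_sum_exceedances hτ fun _ => 1
  simp at h
  lia

theorem isCPInvolution_iff_s10 {r n : ℕ} (z : Fin n → ZMod r) (τ : Equiv.Perm (Fin n)) :
    IsCPInvolution (z, τ) ↔ (∀ i, τ (τ i) = i) ∧ ∀ i, z i + z (τ i) = 0 := by
  simp only [IsCPInvolution, cpMul, cpOne, Prod.mk.injEq, funext_iff, Equiv.ext_iff,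
    Equiv.Perm.mul_apply, Equiv.Perm.one_apply]
  rw [and_comm]
  refine and_congr_right fun hτ => forall_congr' fun i => ?_
  rw [Equiv.Perm.inv_eq_iff_eq.mpr (hτ i).symm]

theorem ZMod.two_mul_val_of_add_self_eq_zero {r : ℕ} {a : ZMod r} (h : a + a = 0) (ha : a ≠ 0) :
    2 * a.val = r :=
  ((ZMod.neg_eq_self_iff a).1 (neg_eq_of_add_eq_zero_left h)).resolve_left ha

theorem two_mul_excClr {r n : ℕ} [NeZero r] {z : Fin n → ZMod r} {τ : Equiv.Perm (Fin n)}
    (hτ : ∀ i, τ (τ i) = i) (hz : ∀ i, z i + z (τ i) = 0) :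
    2 * excClr (z, τ) = r * (2 * #{i | i < τ i} + #{i | τ i = i ∧ z i ≠ 0}) := by
  have hA : excA (z, τ) = ∑ i with i < τ i, if z (τ i) = 0 then 1 else 0 := by
    rw [excA, Nat.card_eq_fintype_card, Fintype.card_subtype, ← Finset.card_filter,
      Finset.filter_filter]
    congr 1
    ext i
    simp
    grind
  have hfix : 2 * ∑ i with τ i = i, (z i).val = r * #{i | τ i = i ∧ z i ≠ 0} := by
    rw [← Finset.filter_filter, Finset.card_filter, Finset.mul_sum, Finset.mul_sum]
    refine Finset.sum_congr rfl fun i hi => ?_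
    have hzi := hz i
    rw [(Finset.mem_filter.1 hi).2] at hzi
    by_cases h0 : z i = 0
    · simp [h0]
    · simp [h0, ZMod.two_mul_val_of_add_self_eq_zero hzi h0]
  have hexc : r * excA (z, τ) + ∑ i with i < τ i, ((z i).val + (z (τ i)).val) =
      r * #{i | i < τ i} := by
    rw [hA, Finset.mul_sum, ← Finset.sum_add_distrib, Finset.card_eq_sum_ones, Finset.mul_sum]
    refine Finset.sum_congr rfl fun i _ => ?_
    have hzi := eq_neg_of_add_eq_zero_left (hz i)
    by_cases h0 : z (τ i) = 0
    · simp [hzi, h0]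
    · have : NeZero (z (τ i)) := ⟨h0⟩
      have := (z (τ i)).val_lt
      rw [hzi, ZMod.val_neg_of_ne_zero]
      simp [h0]
      lia
  have hsum := sum_eq_sum_fixed_add_sum_exceedances hτ fun i => (z i).val
  simp only [excClr, csum]
  rw [hsum]
  linear_combination 2 * hexc + hfix

theorem excClr_eq_mul_iff {r n k : ℕ} [NeZero r] {z : Fin n → ZMod r} {τ : Equiv.Perm (Fin n)}
    (hτ : ∀ i, τ (τ i) = i) (hz : ∀ i, z i + z (τ i) = 0) :
    excClr (z, τ) = r * k ↔ 2 * #{i | i < τ i} + #{i | τ i = i ∧ z i ≠ 0} = 2 * k := by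
  rw [← Nat.mul_right_inj (two_ne_zero), two_mul_excClr hτ hz, mul_left_comm,
    Nat.mul_right_inj (NeZero.ne r)]

/-- An involutive coloring of `τ` amounts to free colors at the exceedances together with the set
of fixed points of color `r / 2`. -/
theorem card_colorings {r n : ℕ} [NeZero r] (heven : Even r) {τ : Equiv.Perm (Fin n)}
    (hτ : ∀ i, τ (τ i) = i) (s : ℕ) :
    #{z : Fin n → ZMod r | (∀ i, z i + z (τ i) = 0) ∧ #{i | τ i = i ∧ z i ≠ 0} = s} =
      r ^ #{i | i < τ i} * (#{i | τ i = i}).choose s := by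
  obtain ⟨h, hh⟩ := heven
  have hr0 := NeZero.pos r
  have hval : (h : ZMod r).val = h := ZMod.val_natCast_of_lt (by lia)
  have hadd : (h : ZMod r) + h = 0 := by
    rw [← Nat.cast_add, ← hh, ZMod.natCast_self]
  have hne : (h : ZMod r) ≠ 0 := by
    intro h0
    rw [h0, ZMod.val_zero] at hval
    lia
  have huniq : ∀ a : ZMod r, a + a = 0 → a ≠ 0 → a = h := fun a ha ha0 =>
    ZMod.val_injective r (by have := ZMod.two_mul_val_of_add_self_eq_zero ha ha0; lia)
  have hcard : #(Fintype.piFinset fun i => if i < τ i then (univ : Finset (ZMod r)) else {0}) =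
      r ^ #{i | i < τ i} := by
    rw [Fintype.card_piFinset, Finset.card_filter, ← Finset.prod_pow_eq_pow_sum]
    refine Finset.prod_congr rfl fun i _ => ?_
    split_ifs <;> simp [ZMod.card]
  rw [← hcard, ← Finset.card_powersetCard, ← Finset.card_product]
  refine Finset.card_bij'
    (fun z _ => (fun i => if i < τ i then z i else 0, ({i | τ i = i ∧ z i ≠ 0} : Finset (Fin n))))
    (fun p _ i => if i < τ i then p.1 i else if τ i < i then -p.1 (τ i) else
      if i ∈ p.2 then (h : ZMod r) else 0) ?_ ?_ ?_ ?_
  · intro z hz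
    simp only [Finset.mem_filter, Finset.mem_univ, true_and] at hz
    simp only [Finset.mem_product, Fintype.mem_piFinset, Finset.mem_powersetCard]
    refine ⟨fun i => ?_, fun i hi => ?_, hz.2⟩
    · split_ifs <;> simp
    · simp_all
  · rintro ⟨g, S⟩ hp
    simp only [Finset.mem_product, Fintype.mem_piFinset, Finset.mem_powersetCard] at hp
    simp only [Finset.mem_filter, Finset.mem_univ, true_and]
    refine ⟨fun i => ?_, ?_⟩
    · rw [hτ]
      rcases lt_trichotomy i (τ i) with hi | hi | hi
      · simp [hi, hi.not_gt]
      · rw [← hi]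
        simp only [lt_irrefl, if_false]
        split_ifs <;> simp [hadd]
      · simp [hi, hi.not_gt]
    · rw [← hp.2.2]
      congr 1
      ext i
      have := @hp.2.1 i
      simp only [Finset.mem_filter, Finset.mem_univ, true_and] at this ⊢
      constructor
      · rintro ⟨h1, h2⟩
        by_contra hS
        simp [h1, hS] at h2
      · intro hS
        simp [this hS, hS, hne]
  · intro z hz
    simp only [Finset.mem_filter, Finset.mem_univ, true_and] at hz
    funext i
    rcases lt_trichotomy i (τ i) with hi | hi | hi
    · simp [hi]
    · have hzi := hz.1 i
      rw [← hi] at hzi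
      by_cases h0 : z i = 0
      · simp [← hi, h0]
      · simp [← hi, huniq _ hzi h0, hne]
    · simp [hi, hi.not_gt, hτ, eq_neg_of_add_eq_zero_left (hz.1 i)]
  · rintro ⟨g, S⟩ hp
    simp only [Finset.mem_product, Fintype.mem_piFinset, Finset.mem_powersetCard] at hp
    refine Prod.ext ?_ ?_
    · funext i
      have := hp.1 i
      by_cases hi : i < τ i
      · simp [hi]
      · simpa [hi, eq_comm] using this
    · ext i
      have := @hp.2.1 i
      simp only [Finset.mem_filter, Finset.mem_univ, true_and] at this ⊢
      constructor
      · rintro ⟨h1, h2⟩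
        by_contra hS
        simp [h1, hS] at h2
      · intro hS
        simp [this hS, hS, hne]

theorem involutive_with_exceedances_iff_cycleType {n p : ℕ} (τ : Equiv.Perm (Fin n)) :
    ((∀ i, τ (τ i) = i) ∧ #{i | i < τ i} = p) ↔ τ.cycleType = Multiset.replicate p 2 := by
  have key : (∀ i, τ (τ i) = i) → #τ.support = 2 * #{i | i < τ i} := fun hτ => by
    have h1 := card_fixed_add_two_mul_card_exceedances hτ
    have h2 := Finset.card_filter_add_card_filter_not (s := univ) (fun i => τ i = i)
    rw [Finset.card_univ, Fintype.card_fin] at h2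
    have h3 : τ.support = univ.filter fun i => ¬ τ i = i := by ext; simp
    rw [h3]
    lia
  have hsq : (∀ i, τ (τ i) = i) ↔ τ ^ 2 = 1 := by
    simp [Equiv.ext_iff, sq]
  constructor
  · rintro ⟨hτ, hp⟩
    have hrep : τ.cycleType = Multiset.replicate (Multiset.card τ.cycleType) 2 := by
      refine Multiset.eq_replicate_card.2 fun m hm => ?_
      have h1 := (Equiv.Perm.dvd_of_mem_cycleType hm).trans (orderOf_dvd_of_pow_eq_one (hsq.1 hτ))
      exact le_antisymm (Nat.le_of_dvd two_pos h1) (Equiv.Perm.two_le_of_mem_cycleType hm)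
    have hs := τ.sum_cycleType
    rw [key hτ, hrep, Multiset.sum_replicate, smul_eq_mul] at hs
    rw [hrep]
    congr 1
    lia
  · intro h
    have hτ : ∀ i, τ (τ i) = i := by
      rw [hsq, ← orderOf_dvd_iff_pow_eq_one, ← Equiv.Perm.lcm_cycleType, h]
      exact Multiset.lcm_dvd.2 fun b hb => (Multiset.eq_of_mem_replicate hb).dvd
    refine ⟨hτ, ?_⟩
    have hs := τ.sum_cycleType
    rw [key hτ, h, Multiset.sum_replicate, smul_eq_mul] at hs
    lia

theorem card_involutive_with_exceedances {n p : ℕ} (hp : 2 * p ≤ n) :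
    (#{τ : Equiv.Perm (Fin n) | (∀ i, τ (τ i) = i) ∧ #{i | i < τ i} = p} : ℚ) =
      n.factorial / ((n - 2 * p).factorial * 2 ^ p * p.factorial) := by
  simp_rw [involutive_with_exceedances_iff_cycleType]
  have h := Equiv.Perm.card_of_cycleType_mul_eq (Fin n) (Multiset.replicate p 2)
  rw [if_pos ⟨by simp; lia, fun a ha => (Multiset.eq_of_mem_replicate ha).ge⟩] at h
  have hprod : ∏ m ∈ (Multiset.replicate p 2).toFinset,
      ((Multiset.replicate p 2).count m).factorial = p.factorial := by
    rcases eq_or_ne p 0 with rfl | h0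
    · simp
    · simp [Multiset.toFinset_replicate, h0]
  rw [hprod, Multiset.sum_replicate, Multiset.prod_replicate, smul_eq_mul, Fintype.card_fin,
    mul_comm p 2] at h
  rw [eq_div_iff (by positivity)]
  exact_mod_cast h

/-- The colorings of an involution `τ` for which the colored excedance number is `r * k`. -/
theorem card_colorings_excClr {r n : ℕ} [NeZero r] (heven : Even r) (k : ℕ)
    {τ : Equiv.Perm (Fin n)} (hτ : ∀ i, τ (τ i) = i) {p : ℕ} (hp : #{i | i < τ i} = p) :
    #{z : Fin n → ZMod r | IsCPInvolution (z, τ) ∧ excClr (z, τ) = r * k} =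
      if p ≤ k then r ^ p * (n - 2 * p).choose (2 * k - 2 * p) else 0 := by
  have hiff : ∀ z : Fin n → ZMod r, IsCPInvolution (z, τ) ∧ excClr (z, τ) = r * k ↔
      p ≤ k ∧ (∀ i, z i + z (τ i) = 0) ∧ #{i | τ i = i ∧ z i ≠ 0} = 2 * k - 2 * p := fun z => by
    rw [isCPInvolution_iff_s10, and_iff_right hτ]
    constructor
    · rintro ⟨hz, he⟩
      rw [excClr_eq_mul_iff hτ hz, hp] at he
      exact ⟨by lia, hz, by lia⟩
    · rintro ⟨hpk, hz, he⟩
      rw [excClr_eq_mul_iff hτ hz, hp]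
      exact ⟨hz, by lia⟩
  simp_rw [hiff]
  split_ifs with hpk
  · have hfix : #{i | τ i = i} = n - 2 * p := by
      have := card_fixed_add_two_mul_card_exceedances hτ
      lia
    simp_rw [hpk, true_and]
    rw [card_colorings heven hτ, hp, hfix]
  · simp [hpk]

theorem multinomialZ_natCast (a b c d : ℕ) :
    (multinomialZ ((a + b + c + d : ℕ) : ℤ) [(a : ℤ), (b : ℤ), (c : ℤ), (d : ℤ)] : ℚ) =
      (a + b + c + d).factorial / (a.factorial * b.factorial * c.factorial * d.factorial) := by
  have hdvd : a.factorial * b.factorial * c.factorial * d.factorial ∣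
      (a + b + c + d).factorial :=
    (mul_dvd_mul_right ((mul_dvd_mul_right (Nat.factorial_mul_factorial_dvd_factorial_add a b)
      _).trans (Nat.factorial_mul_factorial_dvd_factorial_add (a + b) c)) _).trans
      (Nat.factorial_mul_factorial_dvd_factorial_add (a + b + c) d)
  have hcond : (∀ x ∈ [(a : ℤ), (b : ℤ), (c : ℤ), (d : ℤ)], 0 ≤ x) ∧
      [(a : ℤ), (b : ℤ), (c : ℤ), (d : ℤ)].sum = ((a + b + c + d : ℕ) : ℤ) := by
    simp
    ring
  rw [multinomialZ, if_pos hcond]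
  simp only [List.map_cons, List.map_nil, List.prod_cons, List.prod_nil, Int.toNat_natCast,
    mul_one, ← mul_assoc]
  rw [Nat.cast_div hdvd (by positivity)]
  push_cast
  rfl

theorem multinomialZ_eq_zero {n a : ℤ} {l : List ℤ} (hmem : a ∈ l) (ha : a < 0) :
    multinomialZ n l = 0 :=
  if_neg fun h => ha.not_ge (h.1 a hmem)

theorem card_involutive_mul_card_colorings (r : ℕ) {n p : ℕ} (k : ℕ) (hp : 2 * p ≤ n) :
    (n.factorial / ((n - 2 * p).factorial * 2 ^ p * p.factorial) : ℚ) *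
        (if p ≤ k then r ^ p * (n - 2 * p).choose (2 * k - 2 * p) else 0 : ℕ) =
      p.factorial * (multinomialZ n
        [(p : ℤ), (p : ℤ), (n : ℤ) - 2 * k, 2 * (k : ℤ) - 2 * p] : ℚ) * ((r : ℚ) / 2) ^ p := by
  split_ifs with hpk
  · rcases le_or_gt (2 * k) n with hkn | hkn
    · obtain ⟨c, rfl⟩ := Nat.exists_eq_add_of_le hkn
      obtain ⟨d, rfl⟩ := Nat.exists_eq_add_of_le hpk
      have h := multinomialZ_natCast p p c (2 * d)
      rw [show p + p + c + 2 * d = 2 * (p + d) + c by ring] at h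
      rw [show ((2 * (p + d) + c : ℕ) : ℤ) - 2 * (p + d : ℕ) = c by push_cast; ring,
        show 2 * ((p + d : ℕ) : ℤ) - 2 * p = (2 * d : ℕ) by push_cast; ring, h,
        show 2 * (p + d) + c - 2 * p = 2 * d + c by lia,
        show 2 * (p + d) - 2 * p = 2 * d by lia, Nat.cast_mul, Nat.cast_add_choose, Nat.cast_pow,
        div_pow]
      field_simp
    · rw [Nat.choose_eq_zero_of_lt (by lia),
        multinomialZ_eq_zero (a := (n : ℤ) - 2 * k) (by simp) (by lia)]
      simp
  · rw [multinomialZ_eq_zero (a := 2 * (k : ℤ) - 2 * p) (by simp) (by lia)]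
    simp

/-- For even `r ≥ 2` and `m = r·k`, the number of involutions
`π ∈ I_{r,n}` with `exc^Clr π = m` equals
`Σ_{j=⌈n/2⌉}^{n} (n−j)!·C(n; n−j, n−j, n−2k, 2k−2n+2j)·(r/2)^{n−j}`. -/
theorem card_involutions_excClr_even (r n k : ℕ) (hr : 2 ≤ r) (heven : Even r) :
    (Nat.card {π : ColoredPerm r n //
        IsCPInvolution π ∧ excClr π = r * k} : ℚ) =
      ∑ j ∈ Finset.Icc ((n + 1) / 2) n,
        ((n - j).factorial : ℚ) *
          (multinomialZ n
            [(n : ℤ) - j, (n : ℤ) - j, (n : ℤ) - 2 * k,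
              2 * (k : ℤ) - 2 * (n : ℤ) + 2 * j] : ℚ) *
          ((r : ℚ) / 2) ^ (n - j) := by
  have : NeZero r := ⟨by lia⟩
  have hcount : Nat.card {π : ColoredPerm r n // IsCPInvolution π ∧ excClr π = r * k} =
      ∑ τ : Equiv.Perm (Fin n),
        #{z : Fin n → ZMod r | IsCPInvolution (z, τ) ∧ excClr (z, τ) = r * k} := by
    rw [Nat.card_eq_fintype_card, Fintype.card_subtype]
    simp_rw [Finset.card_filter]
    rw [Fintype.sum_prod_type_right]
  have hinv : ∑ τ : Equiv.Perm (Fin n),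
        #{z : Fin n → ZMod r | IsCPInvolution (z, τ) ∧ excClr (z, τ) = r * k} =
      ∑ τ : Equiv.Perm (Fin n) with ∀ i, τ (τ i) = i,
        #{z : Fin n → ZMod r | IsCPInvolution (z, τ) ∧ excClr (z, τ) = r * k} := by
    refine (Finset.sum_filter_of_ne fun τ _ h => ?_).symm
    obtain ⟨z, hz⟩ := Finset.card_ne_zero.1 h
    exact ((isCPInvolution_iff_s10 z τ).1 (Finset.mem_filter.1 hz).2.1).1
  have hmaps : ∀ τ ∈ ({τ | ∀ i, τ (τ i) = i} : Finset (Equiv.Perm (Fin n))),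
      #{i | i < τ i} ∈ Finset.range (n / 2 + 1) := fun τ hτ => by
    have := card_fixed_add_two_mul_card_exceedances (Finset.mem_filter.1 hτ).2
    rw [Finset.mem_range]
    lia
  rw [hcount, hinv, ← Finset.sum_fiberwise_of_maps_to hmaps, Nat.cast_sum]
  refine Finset.sum_bij' (fun p _ => n - p) (fun j _ => n - j) ?_ ?_ ?_ ?_ ?_
  · simp only [Finset.mem_range, Finset.mem_Icc]
    lia
  · simp only [Finset.mem_range, Finset.mem_Icc]
    lia
  · simp only [Finset.mem_range]
    lia
  · simp only [Finset.mem_Icc]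
    lia
  · intro p hp
    rw [Finset.mem_range] at hp
    have hpn : 2 * p ≤ n := by lia
    rw [Finset.filter_filter, Finset.sum_congr rfl fun τ hτ =>
        card_colorings_excClr heven k (Finset.mem_filter.1 hτ).2.1 (Finset.mem_filter.1 hτ).2.2,
      Finset.sum_const, smul_eq_mul, Nat.cast_mul, card_involutive_with_exceedances hpn,
      card_involutive_mul_card_colorings r k hpn, show n - (n - p) = p by lia,
      show (n : ℤ) - (n - p : ℕ) = p by lia,
      show 2 * (k : ℤ) - 2 * (n : ℤ) + 2 * (n - p : ℕ) = 2 * (k : ℤ) - 2 * p by lia]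
end
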